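/- arXiv:2009.03585 — 4 statements merged into one kernel-verified Lean document; each statement's English description precedes it below -/
import Mathlib

section
/- If D is a minimal weakly ST-reachable DAG of G, then every arc (u, v) of D lies on some directed path in D that starts at a vertex of S and ends at a vertex of T. -/
/-- `A` is a weakly ST-reachable DAG on the graph `G` with senders `S` and targets `T`. -/
def IsWSTDAG {V : Type*} (G : SimpleGraph V) (S T : Set V) (A : V → V → Prop) : Prop :=
  (∀ u v, A u v → G.Adj u v) ∧
  (∀ s ∈ S, ∃ t ∈ T, Relation.ReflTransGen A s t) ∧
  (∀ t ∈ T, ∃ s ∈ S, Relation.ReflTransGen A s t) ∧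
  (∀ v w, A v w → ¬ Relation.ReflTransGen A w v)

/-- The arcs `(u, v)` of `A` with `u` reachable from `S` and `T` reachable from `v`. -/
def arcsBetween {V : Type*} (S T : Set V) (A : V → V → Prop) (u v : V) : Prop :=
  A u v ∧ ∃ s ∈ S, ∃ t ∈ T, Relation.ReflTransGen A s u ∧ Relation.ReflTransGen A v t

theorem arcsBetween_reflTransGen {V : Type*} {S T : Set V} {A : V → V → Prop} {s t : V}
    (hs : s ∈ S) (ht : t ∈ T) (h : Relation.ReflTransGen A s t) :
    Relation.ReflTransGen (arcsBetween S T A) s t := by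
  suffices ∀ x, Relation.ReflTransGen A x t → Relation.ReflTransGen A s x →
      Relation.ReflTransGen (arcsBetween S T A) x t from this s h .refl
  intro x hx
  induction hx using Relation.ReflTransGen.head_induction_on with
  | refl => exact fun _ => .refl
  | head hab hbt ih =>
    exact fun hsa => .head ⟨hab, s, hs, t, ht, hsa, hbt⟩ (ih (hsa.tail hab))

theorem IsWSTDAG.arcsBetween {V : Type*} {G : SimpleGraph V} {S T : Set V} {A : V → V → Prop}
    (hA : IsWSTDAG G S T A) : IsWSTDAG G S T (arcsBetween S T A) := by
  obtain ⟨hadj, hsend, htarget, hacyc⟩ := hA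
  refine ⟨fun u v h => hadj u v h.1, fun s hs => ?_, fun t ht => ?_, fun v w h hwv => ?_⟩
  · obtain ⟨t, ht, h⟩ := hsend s hs
    exact ⟨t, ht, arcsBetween_reflTransGen hs ht h⟩
  · obtain ⟨s, hs, h⟩ := htarget t ht
    exact ⟨s, hs, arcsBetween_reflTransGen hs ht h⟩
  · exact hacyc v w h.1 (Relation.ReflTransGen.mono (fun _ _ h => h.1) _ _ hwv)

theorem stmt4 {V : Type*} [Fintype V] [DecidableEq V]
    (G : SimpleGraph V) (hG : G.Connected)
    (S T : Set V) (hS : S.Nonempty) (hT : T.Nonempty) (hST : Disjoint S T)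
    (A : V → V → Prop) (hA : IsWSTDAG G S T A)
    (hmin : ∀ A' : V → V → Prop, (∀ u v, A' u v → A u v) → A' ≠ A → ¬ IsWSTDAG G S T A') :
    ∀ u v, A u v → ∃ s ∈ S, ∃ t ∈ T,
      Relation.ReflTransGen A s u ∧ Relation.ReflTransGen A v t := by
  intro u v huv
  have heq : arcsBetween S T A = A := by
    by_contra hne
    exact hmin _ (fun _ _ h => h.1) hne hA.arcsBetween
  rw [← heq] at huv
  exact huv.2
end

section
/- Let D be a digraph on vertex set V whose arcs are orientations of edges of G, and suppose D satisfies conditions C1 (every s ∈ S reaches some t ∈ T in D) and C2 (every t ∈ T is reachable in D from some s ∈ S). If a vertex w ∈ V \ S has no incoming arc in D, then the digraph obtained from D by deleting all outgoing arcs of w still satisfies C1 and C2. -/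
/-- A path that starts away from a vertex `w` without incoming arcs never leaves `w`. -/
theorem Relation.ReflTransGen.avoid_source {V : Type*} {A : V → V → Prop} {w a b : V}
    (h : Relation.ReflTransGen A a b) (hw : ∀ u, ¬ A u w) (ha : a ≠ w) :
    Relation.ReflTransGen (fun x y => A x y ∧ x ≠ w) a b := by
  induction h using Relation.ReflTransGen.head_induction_on with
  | refl => exact .refl
  | head hac _ ih => exact .head ⟨hac, ha⟩ (ih fun hc => hw _ (hc ▸ hac))

theorem stmt5 {V : Type*} [Fintype V] [DecidableEq V]
    (G : SimpleGraph V) (hG : G.Connected)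
    (S T : Set V) (hS : S.Nonempty) (hT : T.Nonempty) (hST : Disjoint S T)
    (A : V → V → Prop) (hsub : ∀ u v, A u v → G.Adj u v)
    (hC1 : ∀ s ∈ S, ∃ t ∈ T, Relation.ReflTransGen A s t)
    (hC2 : ∀ t ∈ T, ∃ s ∈ S, Relation.ReflTransGen A s t)
    (w : V) (hwS : w ∉ S) (hwIn : ∀ u, ¬ A u w) :
    (∀ s ∈ S, ∃ t ∈ T, Relation.ReflTransGen (fun x y => A x y ∧ x ≠ w) s t) ∧
    (∀ t ∈ T, ∃ s ∈ S, Relation.ReflTransGen (fun x y => A x y ∧ x ≠ w) s t) := by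
  constructor
  · intro s hs
    obtain ⟨t, ht, h⟩ := hC1 s hs
    exact ⟨t, ht, h.avoid_source hwIn (ne_of_mem_of_not_mem hs hwS)⟩
  · intro t ht
    obtain ⟨s, hs, h⟩ := hC2 t ht
    exact ⟨s, hs, h.avoid_source hwIn (ne_of_mem_of_not_mem hs hwS)⟩
end

section
/- Let G = (V, E) be a finite simple connected undirected graph and R ⊆ V nonempty. Let D1 be an acyclic digraph on V every arc of which has both endpoints in R, and let D2 be a digraph on V every arc (u, v) of which satisfies u ∉ R and d(v, R) = d(u, R) − 1, where d(x, R) is the minimum over r ∈ R of the graph distance in G between x and r. Then the digraph on V whose arc set is the union of the arc sets of D1 and D2 is acyclic. -/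
theorem SimpleGraph.sInf_dist_image_eq_zero_iff {V : Type*} {G : SimpleGraph V}
    (hG : G.Connected) {R : Set V} (hR : R.Nonempty) (u : V) :
    sInf (G.dist u '' R) = 0 ↔ u ∈ R := by
  rw [Nat.sInf_eq_zero, or_iff_left (hR.image _).ne_empty]
  constructor
  · rintro ⟨r, hr, h⟩
    rwa [hG.dist_eq_zero_iff.mp h]
  · exact fun hu => ⟨u, hu, SimpleGraph.dist_self⟩

theorem stmt7 {V : Type*} [Fintype V] [DecidableEq V]
    (G : SimpleGraph V) (hG : G.Connected)
    (R : Set V) (hR : R.Nonempty)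
    (A1 A2 : V → V → Prop)
    (hA1R : ∀ u v, A1 u v → u ∈ R ∧ v ∈ R)
    (hA1acyc : ∀ v w, A1 v w → ¬ Relation.ReflTransGen A1 w v)
    (hA2 : ∀ u v, A2 u v → u ∉ R ∧ sInf (G.dist v '' R) = sInf (G.dist u '' R) - 1) :
    ∀ v w, (A1 v w ∨ A2 v w) →
      ¬ Relation.ReflTransGen (fun x y => A1 x y ∨ A2 x y) w v := by
  have hzero := SimpleGraph.sInf_dist_image_eq_zero_iff hG hR
  rintro v w (h | h) hwv
  · have key : ∀ x, Relation.ReflTransGen (fun x y => A1 x y ∨ A2 x y) w x →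
        x ∈ R ∧ Relation.ReflTransGen A1 w x := by
      intro x hx
      induction hx with
      | refl => exact ⟨(hA1R v w h).2, .refl⟩
      | tail _ hbc ih =>
        rcases hbc with hbc | hbc
        · exact ⟨(hA1R _ _ hbc).2, ih.2.tail hbc⟩
        · exact absurd ih.1 (hA2 _ _ hbc).1
    exact hA1acyc v w h (key v hwv).2
  · have key : ∀ x, Relation.ReflTransGen (fun x y => A1 x y ∨ A2 x y) w x →
        sInf (G.dist x '' R) ≤ sInf (G.dist w '' R) := by
      intro x hx
      induction hx with
      | refl => exact le_rfl
      | tail _ hbc ih =>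
        rcases hbc with hbc | hbc
        · rw [(hzero _).mpr (hA1R _ _ hbc).2]
          exact Nat.zero_le _
        · rw [(hA2 _ _ hbc).2]
          exact (Nat.sub_le _ _).trans ih
    obtain ⟨hv, hd⟩ := hA2 v w h
    have hpos := mt (hzero v).mp hv
    have hle := key v hwv
    omega
end

section
/- Let G = (V, E) be a finite simple connected undirected graph and let S, T ⊆ V be nonempty and disjoint. Let p1 : V → V satisfy p1(s) = s for s ∈ S and, for v ∉ S, p1(v) adjacent to v with d(p1(v), S) = d(v, S) − 1. Define Red = { v ∈ V : ∃ u ∈ T, ∃ k ≥ 0, p1^k(u) = v } (so T ⊆ Red and Red is nonempty). Let p2 : V → V satisfy p2(v) = v for v ∈ Red and, for v ∉ Red, p2(v) adjacent to v with d(p2(v), Red) = d(v, Red) − 1. Define Blue = { v ∈ V \ Red : ∃ u ∈ S, ∃ k ≥ 0, p2^k(u) = v }. Let D be the digraph on V whose arc set is { (v, u) : u, v ∈ Red, p1(u) = v, u ≠ v } ∪ { (v, p2(v)) : v ∈ Blue }. Then D is a weakly ST-reachable DAG of G: D is acyclic, every s ∈ S reaches some t ∈ T in D, and every t ∈ T is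 reachable in D from some s ∈ S. -/
theorem SimpleGraph.Connected.sInf_dist_image_pos {V : Type*} {G : SimpleGraph V}
    (hG : G.Connected) {X : Set V} (hX : X.Nonempty) {v : V} (hv : v ∉ X) :
    0 < sInf (G.dist v '' X) := by
  obtain ⟨x, hx, hxv⟩ := Nat.sInf_mem (hX.image (G.dist v))
  rw [← hxv]
  exact hG.pos_dist_of_ne fun h => hv (h ▸ hx)

theorem exists_iterate_mem_of_decreasing {V : Type*} {X : Set V} {p : V → V} (d : V → ℕ)
    (h : ∀ v ∉ X, d (p v) < d v) (v : V) : ∃ k, p^[k] v ∈ X := by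
  induction hn : d v using Nat.strong_induction_on generalizing v with
  | _ n ih =>
    by_cases hv : v ∈ X
    · exact ⟨0, hv⟩
    · obtain ⟨k, hk⟩ := ih _ (hn ▸ h v hv) (p v) rfl
      exact ⟨k + 1, hk⟩

theorem stmt11 {V : Type*} [Fintype V] [DecidableEq V]
    (G : SimpleGraph V) (hG : G.Connected)
    (S T : Set V) (hS : S.Nonempty) (hT : T.Nonempty) (hST : Disjoint S T)
    (p1 : V → V)
    (hp1S : ∀ s ∈ S, p1 s = s)
    (hp1 : ∀ v ∉ S, G.Adj v (p1 v) ∧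
      sInf (G.dist (p1 v) '' S) = sInf (G.dist v '' S) - 1)
    (Red : Set V) (hRed : Red = {v | ∃ u ∈ T, ∃ k, p1^[k] u = v})
    (p2 : V → V)
    (hp2R : ∀ v ∈ Red, p2 v = v)
    (hp2 : ∀ v ∉ Red, G.Adj v (p2 v) ∧
      sInf (G.dist (p2 v) '' Red) = sInf (G.dist v '' Red) - 1)
    (Blue : Set V)
    (hBlue : Blue = {v | v ∉ Red ∧ ∃ u ∈ S, ∃ k, p2^[k] u = v})
    (A : V → V → Prop)
    (hA : ∀ x y, A x y ↔
      (x ∈ Red ∧ y ∈ Red ∧ p1 y = x ∧ y ≠ x) ∨ (x ∈ Blue ∧ y = p2 x)) :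
    (∀ u v, A u v → G.Adj u v) ∧
    (∀ v w, A v w → ¬ Relation.ReflTransGen A w v) ∧
    (∀ s ∈ S, ∃ t ∈ T, Relation.ReflTransGen A s t) ∧
    (∀ t ∈ T, ∃ s ∈ S, Relation.ReflTransGen A s t) := by
  have d1 : ∀ v ∉ S, sInf (G.dist (p1 v) '' S) < sInf (G.dist v '' S) := fun v hv => by
    have := hG.sInf_dist_image_pos hS hv
    have := (hp1 v hv).2
    omega
  have hTR : ∀ t ∈ T, t ∈ Red := fun t ht => hRed ▸ ⟨t, ht, 0, rfl⟩
  have hRne : Red.Nonempty := hT.mono hTR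
  have d2 : ∀ v ∉ Red, sInf (G.dist (p2 v) '' Red) < sInf (G.dist v '' Red) := fun v hv => by
    have := hG.sInf_dist_image_pos hRne hv
    have := (hp2 v hv).2
    omega
  have hBR : ∀ v ∈ Blue, v ∉ Red := fun v hv => by
    rw [hBlue] at hv
    exact hv.1
  have notMem_S : ∀ x y, p1 y = x → y ≠ x → y ∉ S := fun x y h hne hy =>
    hne ((hp1S y hy).symm.trans h)
  have p1_Red : ∀ v ∈ Red, p1 v ∈ Red := fun v hv => by
    rw [hRed] at hv ⊢
    obtain ⟨u, hu, k, rfl⟩ := hv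
    exact ⟨u, hu, k + 1, Function.iterate_succ_apply' p1 k u⟩
  have p1_iter : ∀ t ∈ T, ∀ k, Relation.ReflTransGen A (p1^[k] t) t := fun t ht k => by
    induction k with
    | zero => exact .refl
    | succ k ih =>
      have hR : p1^[k] t ∈ Red := hRed ▸ ⟨t, ht, k, rfl⟩
      rw [Function.iterate_succ_apply']
      by_cases he : p1^[k] t = p1 (p1^[k] t)
      · rwa [← he]
      · exact .head ((hA _ _).2 (.inl ⟨p1_Red _ hR, hR, rfl, he⟩)) ih
  have p2_iter : ∀ s ∈ S, ∀ k, Relation.ReflTransGen A s (p2^[k] s) := fun s hs k => by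
    induction k with
    | zero => exact .refl
    | succ k ih =>
      rw [Function.iterate_succ_apply']
      by_cases hR : p2^[k] s ∈ Red
      · rwa [hp2R _ hR]
      · exact ih.tail ((hA _ _).2 (.inr ⟨hBlue ▸ ⟨hR, s, hs, k, rfl⟩, rfl⟩))
  refine ⟨fun u v h => ?_, fun v w hvw hwv => ?_, fun s hs => ?_, fun t ht => ?_⟩
  · rcases (hA u v).1 h with ⟨-, -, h, hne⟩ | ⟨hu, rfl⟩
    · exact h ▸ (hp1 v (notMem_S u v h hne)).1.symm
    · exact (hp2 u (hBR u hu)).1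
  · classical
    let rank : V → ℤ := fun v =>
      if v ∈ Red then -(sInf (G.dist v '' S) : ℕ) else (sInf (G.dist v '' Red) : ℕ)
    have rank_lt : ∀ x y, A x y → rank y < rank x := fun x y h => by
      rcases (hA x y).1 h with ⟨hx, hy, h, hne⟩ | ⟨hx, rfl⟩
      · have := d1 y (notMem_S x y h hne)
        rw [h] at this
        simp only [rank, hx, hy, if_true]
        omega
      · have := d2 x (hBR x hx)
        simp only [rank, hBR x hx, if_false]
        split_ifs <;> omega
    have rank_le : rank v ≤ rank w := by
      clear hvw
      induction hwv with
      | refl => exact le_rfl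
      | tail _ h ih => exact (rank_lt _ _ h).le.trans ih
    exact (rank_lt v w hvw).not_ge rank_le
  · obtain ⟨k, hk⟩ := exists_iterate_mem_of_decreasing (fun v => sInf (G.dist v '' Red)) d2 s
    have hk' := hk
    rw [hRed] at hk'
    obtain ⟨t, ht, j, hj⟩ := hk'
    exact ⟨t, ht, (p2_iter s hs k).trans (hj ▸ p1_iter t ht j)⟩
  · obtain ⟨k, hk⟩ := exists_iterate_mem_of_decreasing (fun v => sInf (G.dist v '' S)) d1 t
    exact ⟨_, hk, p1_iter t ht k⟩
end
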